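/- Under the (P4+kP3)-free setup, suppose that no minimum total dominating set of G contains a P3, and let D be a minimum total dominating set of G. Let 𝒞 be a set of C-edges of D that pairwise have distance at least three from one another, and suppose that for every subset E ⊆ 𝒞 of cardinality k+1 there exists an induced path on four vertices in G that contains exactly two vertices from the edges of E, these two vertices belonging to two different edges of E. Then |𝒞| < (k²/2 + 3k/2)(k²/2 + 3k/2 + 1) + k + 1. -/

import Mathlib

open SimpleGraph

namespace TD

variable {V : Type*} {α β : Type*}

/-- `D` is a total dominating set of `G`: every vertex has a neighbor in `D`. -/
def IsTotalDomSet (G : SimpleGraph V) (D : Set V) : Prop :=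
  ∀ v : V, ∃ u ∈ D, G.Adj v u

/-- The total domination number `γ_t(G)`. -/
noncomputable def totalDomNum (G : SimpleGraph V) : ℕ :=
  sInf {m : ℕ | ∃ D : Set V, IsTotalDomSet G D ∧ D.ncard = m}

/-- A minimum total dominating set. -/
def IsMinTotalDomSet (G : SimpleGraph V) (D : Set V) : Prop :=
  IsTotalDomSet G D ∧ D.ncard = totalDomNum G

/-- `S` contains a `P3`: three distinct vertices `a, b, c ∈ S` with `ab, bc ∈ E(G)`. -/
def HasP3 (G : SimpleGraph V) (S : Set V) : Prop :=
  ∃ a b c : V, a ∈ S ∧ b ∈ S ∧ c ∈ S ∧ a ≠ b ∧ b ≠ c ∧ a ≠ c ∧ G.Adj a b ∧ G.Adj b c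

/-- `D` is a dominating set of `G`. -/
def IsDomSet (G : SimpleGraph V) (D : Set V) : Prop :=
  ∀ v ∉ D, ∃ u ∈ D, G.Adj v u

/-- The domination number `γ(G)`. -/
noncomputable def domNum (G : SimpleGraph V) : ℕ :=
  sInf {m : ℕ | ∃ D : Set V, IsDomSet G D ∧ D.ncard = m}

/-- The (open) neighborhood of a set `S`: union of the neighborhoods of its members. -/
def nbhd (G : SimpleGraph V) (S : Set V) : Set V :=
  {v | ∃ u ∈ S, G.Adj u v}

/-- The closed neighborhood `N[S]`. -/
def closedNbhd (G : SimpleGraph V) (S : Set V) : Set V :=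
  S ∪ nbhd G S

/-- Distance between two sets of vertices. -/
noncomputable def setDist (G : SimpleGraph V) (S T : Set V) : ℕ :=
  sInf {m : ℕ | ∃ u ∈ S, ∃ v ∈ T, G.dist u v = m}

/-- `k` disjoint copies of `H`. -/
def kCopies (k : ℕ) (H : SimpleGraph α) : SimpleGraph (Fin k × α) where
  Adj p q := p.1 = q.1 ∧ H.Adj p.2 q.2
  symm := ⟨fun _ _ h => ⟨h.1.symm, h.2.symm⟩⟩
  loopless := ⟨fun p h => H.loopless.irrefl p.2 h.2⟩

/-- The graph `P4 + k·P3`. -/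
def p4kp3 (k : ℕ) : SimpleGraph (Fin 4 ⊕ (Fin k × Fin 3)) :=
  (pathGraph 4) ⊕g (kCopies k (pathGraph 3))

/-- `G` contains no induced copy of `H` (`G` is `H`-free). -/
def IndFree (G : SimpleGraph V) (H : SimpleGraph α) : Prop :=
  ¬ Nonempty (H ↪g G)

/-- `K` is a maximal clique of the subgraph of `G` induced by `C`. -/
def IsMaxCliqueWithin (G : SimpleGraph V) (C K : Set V) : Prop :=
  K ⊆ C ∧ G.IsClique K ∧ ∀ K' : Set V, K' ⊆ C → G.IsClique K' → K ⊆ K' → K' = K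

/-- Member of `𝒦'`: a maximal clique of `G[C]` whose closed neighborhood contains no
induced `P4` and such that no vertex of `B` is adjacent to all of its vertices. -/
def GoodClique (G : SimpleGraph V) (B C K : Set V) : Prop :=
  IsMaxCliqueWithin G C K ∧
    IndFree (G.induce (closedNbhd G K)) (pathGraph 4) ∧
    ¬ ∃ b ∈ B, ∀ x ∈ K, G.Adj b x

/-- A regular clique: a member of `𝒦'` for which there are `k` other members of `𝒦'`
pairwise at distance at least four from one another and from it. -/
def RegularClique (G : SimpleGraph V) (k : ℕ) (B C K : Set V) : Prop :=
  GoodClique G B C K ∧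
    ∃ Ks : Fin k → Set V,
      (∀ i, GoodClique G B C (Ks i)) ∧
      (∀ i, 4 ≤ setDist G K (Ks i)) ∧
      ∀ i j : Fin k, i ≠ j → 4 ≤ setDist G (Ks i) (Ks j)

/-- `w` is a private neighbor of `v` with respect to `D`: `N(w) ∩ D = {v}`. -/
def IsPrivateNbr (G : SimpleGraph V) (D : Set V) (v w : V) : Prop :=
  {u | u ∈ D ∧ G.Adj w u} = {v}

end TD

open TD SimpleGraph

namespace TD

section Pendants

variable {V : Type*} {G : SimpleGraph V}

/-- Distinct members of `𝒞` are disjoint, non-adjacent, and have no common neighbor. -/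
def FarApart (G : SimpleGraph V) (𝒞 : Set (Sym2 V)) : Prop :=
  ∀ e ∈ 𝒞, ∀ e' ∈ 𝒞, e ≠ e' → ∀ x ∈ e, ∀ y ∈ e',
    x ≠ y ∧ ¬ G.Adj x y ∧ ∀ z, G.Adj z x → ¬ G.Adj z y

/-- `z` is an end of `e` or adjacent to one. -/
def Attached (G : SimpleGraph V) (e : Sym2 V) (z : V) : Prop :=
  ∃ x ∈ e, z = x ∨ G.Adj z x

lemma FarApart.not_adj {𝒞 : Set (Sym2 V)} (h : FarApart G 𝒞) {e e' : Sym2 V} (he : e ∈ 𝒞)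
    (he' : e' ∈ 𝒞) (hne : e ≠ e') {z y : V} (hz : Attached G e z) (hy : y ∈ e') :
    ¬ G.Adj z y := by
  obtain ⟨x, hx, rfl | hzx⟩ := hz
  · exact (h e he e' he' hne _ hx y hy).2.1
  · exact (h e he e' he' hne x hx y hy).2.2 z hzx

lemma FarApart.ne {𝒞 : Set (Sym2 V)} (h : FarApart G 𝒞) {e e' : Sym2 V} (he : e ∈ 𝒞)
    (he' : e' ∈ 𝒞) (hne : e ≠ e') {z y : V} (hz : Attached G e z) (hy : Attached G e' y) :
    z ≠ y := by
  rintro rfl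
  obtain ⟨y, hy, rfl | hzy⟩ := hy
  · obtain ⟨x, hx, rfl | hzx⟩ := hz
    · exact (h e he e' he' hne _ hx _ hy).1 rfl
    · exact (h e he e' he' hne x hx _ hy).2.1 hzx.symm
  · exact h.not_adj he he' hne hz hy hzy

/-- An edge with a vertex attached to it: the edge joins `near` and `far`, and `leaf` is a
further neighbor of `near`. -/
structure Pendant (V : Type*) where
  near : V
  far : V
  leaf : V

/-- `t` is an extension of the edge `e` by a further neighbor of one of its ends. -/
structure IsPendant (G : SimpleGraph V) (e : Sym2 V) (t : Pendant V) : Prop where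
  edge_eq : s(t.near, t.far) = e
  adj : G.Adj t.near t.far
  leaf_adj : G.Adj t.leaf t.near
  leaf_ne : t.leaf ≠ t.far

/-- A pendant whose three vertices induce a path. -/
structure IsInducedPendant (G : SimpleGraph V) (e : Sym2 V) (t : Pendant V) : Prop
    extends IsPendant G e t where
  leaf_not_adj : ¬ G.Adj t.leaf t.far

namespace IsPendant

variable {e : Sym2 V} {t : Pendant V}

lemma near_mem (h : IsPendant G e t) : t.near ∈ e := by
  rw [← h.edge_eq]; exact Sym2.mem_mk_left _ _

lemma far_mem (h : IsPendant G e t) : t.far ∈ e := by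
  rw [← h.edge_eq]; exact Sym2.mem_mk_right _ _

lemma attached_near (h : IsPendant G e t) : Attached G e t.near := ⟨_, h.near_mem, .inl rfl⟩

lemma attached_far (h : IsPendant G e t) : Attached G e t.far := ⟨_, h.far_mem, .inl rfl⟩

lemma attached_leaf (h : IsPendant G e t) : Attached G e t.leaf :=
  ⟨_, h.near_mem, .inr h.leaf_adj⟩

end IsPendant

/-- Replacing, in a selection of pendants with two adjacent leaves, the far ends by the leaves
leaves some vertex undominated; it is a new leaf at one of the far ends. -/
def HasExchange (G : SimpleGraph V) (𝒞 : Set (Sym2 V)) : Prop :=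
  ∀ (I : Finset (Sym2 V)) (τ : Sym2 V → Pendant V),
    (∀ e ∈ I, e ∈ 𝒞 ∧ IsPendant G e (τ e)) →
    (∃ e ∈ I, ∃ f ∈ I, e ≠ f ∧ G.Adj (τ e).leaf (τ f).leaf) →
    ∃ l ∈ I, ∃ v, IsInducedPendant G l ⟨(τ l).far, (τ l).near, v⟩ ∧
      ∀ m ∈ I, ¬ G.Adj v (τ m).leaf

/-- A selection of induced pendants at the edges in `L`, with pairwise non-adjacent leaves. -/
structure IndepSel (G : SimpleGraph V) (𝒞 : Set (Sym2 V)) (L : Finset (Sym2 V))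
    (τ : Sym2 V → Pendant V) : Prop where
  mem : ∀ e ∈ L, e ∈ 𝒞
  pendant : ∀ e ∈ L, IsInducedPendant G e (τ e)
  indep : ∀ e ∈ L, ∀ f ∈ L, e ≠ f → ¬ G.Adj (τ e).leaf (τ f).leaf

/-- No set of at most `r` edges covers all adjacencies between leaves of pendants at `J`. -/
def Uncovered (G : SimpleGraph V) (J : Finset (Sym2 V)) (τ : Sym2 V → Pendant V) (r : ℕ) : Prop :=
  ∀ X : Finset (Sym2 V), X.card ≤ r →
    ∃ e ∈ J, ∃ f ∈ J, e ∉ X ∧ f ∉ X ∧ e ≠ f ∧ G.Adj (τ e).leaf (τ f).leaf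

lemma IndepSel.mono {𝒞 : Set (Sym2 V)} {L L' : Finset (Sym2 V)} {τ : Sym2 V → Pendant V}
    (h : IndepSel G 𝒞 L τ) (hL : L' ⊆ L) : IndepSel G 𝒞 L' τ :=
  ⟨fun e he => h.mem e (hL he), fun e he => h.pendant e (hL he),
    fun e he f hf => h.indep e (hL he) f (hL hf)⟩

lemma IndepSel.congr {𝒞 : Set (Sym2 V)} {L : Finset (Sym2 V)} {τ τ' : Sym2 V → Pendant V}
    (h : IndepSel G 𝒞 L τ) (hτ : ∀ e ∈ L, τ' e = τ e) : IndepSel G 𝒞 L τ' :=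
  ⟨h.mem, fun e he => by rw [hτ e he]; exact h.pendant e he,
    fun e he f hf => by rw [hτ e he, hτ f hf]; exact h.indep e he f hf⟩

open Classical in
lemma IndepSel.insert {𝒞 : Set (Sym2 V)} {L : Finset (Sym2 V)} {τ : Sym2 V → Pendant V}
    (h : IndepSel G 𝒞 L τ) {l : Sym2 V} (hl : l ∈ 𝒞) (hlL : l ∉ L)
    (ht : IsInducedPendant G l (τ l)) (hanti : ∀ m ∈ L, ¬ G.Adj (τ l).leaf (τ m).leaf) :
    IndepSel G 𝒞 (insert l L) τ := by
  refine ⟨?_, ?_, ?_⟩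
  · intro e he
    rcases Finset.mem_insert.1 he with rfl | he
    exacts [hl, h.mem e he]
  · intro e he
    rcases Finset.mem_insert.1 he with rfl | he
    exacts [ht, h.pendant e he]
  · intro e he f hf hne
    rcases Finset.mem_insert.1 he with rfl | he' <;> rcases Finset.mem_insert.1 hf with rfl | hf'
    · exact (hne rfl).elim
    · exact hanti f hf'
    · exact fun hadj => hanti e he' hadj.symm
    · exact h.indep e he' f hf' hne

open Classical in
lemma IndepSel.insert_update {𝒞 : Set (Sym2 V)} {L : Finset (Sym2 V)} {τ : Sym2 V → Pendant V}
    (h : IndepSel G 𝒞 L τ) {l : Sym2 V} (hl : l ∈ 𝒞) (hlL : l ∉ L) {t : Pendant V}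
    (ht : IsInducedPendant G l t) (hanti : ∀ m ∈ L, ¬ G.Adj t.leaf (τ m).leaf) :
    IndepSel G 𝒞 (Insert.insert l L) (Function.update τ l t) := by
  have hne : ∀ m ∈ L, Function.update τ l t m = τ m := fun m hm =>
    Function.update_of_ne (ne_of_mem_of_not_mem hm hlL) _ _
  refine (h.congr hne).insert hl hlL (by simpa using ht) fun m hm => ?_
  rw [hne m hm]
  simpa using hanti m hm

/-- Four vertices inducing a path give an embedding of `pathGraph 4`. -/
lemma exists_pathGraph_four_embedding {a b c d : V} (hab : G.Adj a b) (hbc : G.Adj b c)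
    (hcd : G.Adj c d) (hac : ¬ G.Adj a c) (had : ¬ G.Adj a d) (hbd : ¬ G.Adj b d) :
    ∃ g : pathGraph 4 ↪g G, ∀ P : V → Prop, P a → P b → P c → P d → ∀ r, P (g r) := by
  have h1 : a ≠ c := fun h => had (h ▸ hcd)
  have h2 : a ≠ d := fun h => hbd (h ▸ hab.symm)
  have h3 : b ≠ d := fun h => had (h ▸ hab)
  have h4 := hab.ne
  have h5 := hbc.ne
  have h6 := hcd.ne
  have hca : ¬ G.Adj c a := fun h => hac h.symm
  have hda : ¬ G.Adj d a := fun h => had h.symm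
  have hdb : ¬ G.Adj d b := fun h => hbd h.symm
  have hadj : ∀ i j, G.Adj (![a, b, c, d] i) (![a, b, c, d] j) ↔ (pathGraph 4).Adj i j := by
    intro i j
    fin_cases i <;> fin_cases j <;>
      simp [pathGraph_adj, hab, hbc, hcd, hac, had, hbd, hab.symm, hbc.symm, hcd.symm,
        hca, hda, hdb]
  refine ⟨⟨⟨![a, b, c, d], ?_⟩, fun {i j} => hadj i j⟩, ?_⟩
  · intro i j
    fin_cases i <;> fin_cases j <;>
      simp [h1, h2, h3, h4, h5, h6, h1.symm, h2.symm, h3.symm, h4.symm, h5.symm, h6.symm]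
  · intro P ha hb hc hd r
    fin_cases r <;> assumption

/-- An induced `P4` together with `k` pairwise anticomplete pendants, all attached to
different edges, is an induced `P4 + kP3`. -/
lemma not_indFree_of_indepSel {𝒞 : Set (Sym2 V)} (hfar : FarApart G 𝒞) {k : ℕ}
    {W : Finset (Sym2 V)} {τ : Sym2 V → Pendant V} (hW : IndepSel G 𝒞 W τ) (hk : k ≤ W.card)
    {a b c d : V} (hab : G.Adj a b) (hbc : G.Adj b c)
    (hcd : G.Adj c d) (hac : ¬ G.Adj a c) (had : ¬ G.Adj a d) (hbd : ¬ G.Adj b d)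
    (ha : ∀ m ∈ W, ¬ G.Adj a (τ m).leaf) (hb : ∀ m ∈ W, ¬ G.Adj b (τ m).leaf)
    (hc : ∀ m ∈ W, ¬ G.Adj c (τ m).leaf) (hd : ∀ m ∈ W, ¬ G.Adj d (τ m).leaf)
    (ha' : ∃ l ∈ 𝒞, l ∉ W ∧ Attached G l a) (hb' : ∃ l ∈ 𝒞, l ∉ W ∧ Attached G l b)
    (hc' : ∃ l ∈ 𝒞, l ∉ W ∧ Attached G l c) (hd' : ∃ l ∈ 𝒞, l ∉ W ∧ Attached G l d) :
    ¬ IndFree G (p4kp3 k) := by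
  obtain ⟨g, hg⟩ := exists_pathGraph_four_embedding hab hbc hcd hac had hbd
  have hg1 := hg (fun z => ∀ m ∈ W, ¬ G.Adj z (τ m).leaf) ha hb hc hd
  have hg2 := hg (fun z => ∃ l ∈ 𝒞, l ∉ W ∧ Attached G l z) ha' hb' hc' hd'
  clear hg
  obtain ⟨w, hw⟩ : ∃ w : Fin k → Sym2 V, Function.Injective w ∧ ∀ i, w i ∈ W := by
    refine ⟨fun i => (W.equivFin.symm (Fin.castLE hk i) : Sym2 V), ?_, fun i => Subtype.prop _⟩
    intro i j hij
    simpa using hij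
  obtain ⟨hwi, hwW⟩ := hw
  let t : Fin k → Fin 3 → V := fun i => ![(τ (w i)).leaf, (τ (w i)).near, (τ (w i)).far]
  have hatt : ∀ i r, Attached G (w i) (t i r) := by
    intro i r
    have hp := (hW.pendant _ (hwW i)).toIsPendant
    fin_cases r
    exacts [hp.attached_leaf, hp.attached_near, hp.attached_far]
  have hanti : ∀ (i : Fin k) (l : Sym2 V) (z : V), l ∈ 𝒞 → l ≠ w i → Attached G l z →
      ¬ G.Adj z (τ (w i)).leaf → ∀ r, z ≠ t i r ∧ ¬ G.Adj z (t i r) := by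
    intro i l z hl hne hz hleaf r
    have hp := (hW.pendant _ (hwW i)).toIsPendant
    refine ⟨hfar.ne hl (hW.mem _ (hwW i)) hne hz (hatt i r), ?_⟩
    fin_cases r
    exacts [hleaf, hfar.not_adj hl (hW.mem _ (hwW i)) hne hz hp.near_mem,
      hfar.not_adj hl (hW.mem _ (hwW i)) hne hz hp.far_mem]
  have hgt : ∀ r i r', g r ≠ t i r' ∧ ¬ G.Adj (g r) (t i r') := by
    intro r i r'
    obtain ⟨l, hl, hlW, hz⟩ := hg2 r
    exact hanti i l (g r) hl (fun h => hlW (h ▸ hwW i)) hz (hg1 r _ (hwW i)) r'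
  have htt : ∀ i j, i ≠ j → ∀ r r', t i r ≠ t j r' ∧ ¬ G.Adj (t i r) (t j r') := by
    intro i j hij r r'
    have hij' : w i ≠ w j := fun h => hij (hwi h)
    have hp := (hW.pendant _ (hwW i)).toIsPendant
    have hq := (hW.pendant _ (hwW j)).toIsPendant
    refine hanti j (w i) (t i r) (hW.mem _ (hwW i)) hij' (hatt i r) ?_ r'
    fin_cases r
    · exact hW.indep _ (hwW i) _ (hwW j) hij'
    · exact fun h => hfar.not_adj (hW.mem _ (hwW j)) (hW.mem _ (hwW i)) hij'.symm
        hq.attached_leaf hp.near_mem h.symm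
    · exact fun h => hfar.not_adj (hW.mem _ (hwW j)) (hW.mem _ (hwW i)) hij'.symm
        hq.attached_leaf hp.far_mem h.symm
  have hin : ∀ i r r', (t i r = t i r' → r = r') ∧
      (G.Adj (t i r) (t i r') ↔ (pathGraph 3).Adj r r') := by
    intro i r r'
    obtain ⟨⟨-, h1, h2, h3⟩, h4⟩ := hW.pendant _ (hwW i)
    have h5 := h1.ne
    have h6 := h2.ne
    fin_cases r <;> fin_cases r' <;>
      simp [t, pathGraph_adj, G.adj_comm, *] <;> simp_all [eq_comm, G.adj_comm]
  intro hfree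
  have hadj : ∀ x y, G.Adj (Sum.elim g (fun q => t q.1 q.2) x)
      (Sum.elim g (fun q => t q.1 q.2) y) ↔ (p4kp3 k).Adj x y := by
    rintro (r | ⟨i, r⟩) (r' | ⟨j, r'⟩)
    · simp [p4kp3]
    · simpa [p4kp3] using (hgt r j r').2
    · simpa [p4kp3, G.adj_comm] using (hgt r' i r).2
    · by_cases hij : i = j
      · subst hij
        simpa [p4kp3, kCopies] using (hin i r r').2
      · simpa [p4kp3, kCopies, hij] using (htt i j hij r r').2
  refine hfree ⟨⟨⟨Sum.elim g fun q => t q.1 q.2, ?_⟩, fun {x y} => hadj x y⟩⟩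
  · rintro (r | ⟨i, r⟩) (r' | ⟨j, r'⟩) h
    · exact congrArg _ (g.injective h)
    · exact ((hgt r j r').1 h).elim
    · exact ((hgt r' i r).1 h.symm).elim
    · by_cases hij : i = j
      · subst hij
        rw [(hin i r r').1 h]
      · exact ((htt i j hij r r').1 h).elim

/-- Exchanges enlarge selections of pendants with pairwise non-adjacent leaves. -/
lemma HasExchange.exists_indepSel {𝒞 : Set (Sym2 V)} (hex : HasExchange G 𝒞) (m : ℕ) :
    ∀ T : Finset (Sym2 V), (∀ e ∈ T, e ∈ 𝒞 ∧ ∃ t, IsInducedPendant G e t) →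
      1 + m * (m + 1) / 2 ≤ T.card →
      ∃ S ⊆ T, S.card = m + 1 ∧ ∃ τ, IndepSel G 𝒞 S τ := by
  classical
  induction m with
  | zero =>
    intro T hT hcard
    obtain ⟨e, he⟩ := Finset.card_pos.1 (by omega : 0 < T.card)
    obtain ⟨he', t, ht⟩ := hT e he
    refine ⟨{e}, by simpa using he, by simp, fun _ => t, ?_, ?_, ?_⟩ <;> simp_all
  | succ m ih =>
    intro T hT hcard
    have hsum : (m + 1) * (m + 1 + 1) / 2 = m * (m + 1) / 2 + (m + 1) := by
      rw [show (m + 1) * (m + 1 + 1) = m * (m + 1) + (m + 1) * 2 by ring,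
        Nat.add_mul_div_right _ _ (by norm_num)]
    obtain ⟨S₁, hS₁, hc₁, τ₁, hτ₁⟩ := ih T hT (by omega)
    obtain ⟨S₂, hS₂, hc₂, τ₂, hτ₂⟩ := ih (T \ S₁)
      (fun e he => hT e (Finset.mem_sdiff.1 he).1)
      (by rw [Finset.card_sdiff_of_subset hS₁]; omega)
    have hdisj : ∀ e ∈ S₂, e ∉ S₁ := fun e he => (Finset.mem_sdiff.1 (hS₂ he)).2
    have hS₂T : S₂ ⊆ T := fun e he => (Finset.mem_sdiff.1 (hS₂ he)).1
    let τ : Sym2 V → Pendant V := fun e => if e ∈ S₁ then τ₁ e else τ₂ e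
    replace hτ₁ : IndepSel G 𝒞 S₁ τ := hτ₁.congr fun e he => if_pos he
    replace hτ₂ : IndepSel G 𝒞 S₂ τ := hτ₂.congr fun e he => if_neg (hdisj e he)
    by_cases hadj : ∃ e ∈ S₁ ∪ S₂, ∃ f ∈ S₁ ∪ S₂, e ≠ f ∧ G.Adj (τ e).leaf (τ f).leaf
    · obtain ⟨l, hl, v, hv, hanti⟩ := hex (S₁ ∪ S₂) τ (fun e he => by
        rcases Finset.mem_union.1 he with he | he
        exacts [⟨hτ₁.mem e he, (hτ₁.pendant e he).toIsPendant⟩,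
          ⟨hτ₂.mem e he, (hτ₂.pendant e he).toIsPendant⟩]) hadj
      rcases Finset.mem_union.1 hl with hl | hl
      · have hl2 : l ∉ S₂ := fun h => hdisj l h hl
        refine ⟨insert l S₂, Finset.insert_subset (hS₁ hl) hS₂T, ?_, _,
          hτ₂.insert_update (hτ₁.mem l hl) hl2 hv fun m hm => ?_⟩
        · rw [Finset.card_insert_of_notMem hl2, hc₂]
        · exact hanti m (Finset.mem_union_right _ hm)
      · have hl2 : l ∉ S₁ := hdisj l hl
        refine ⟨insert l S₁, Finset.insert_subset (hS₂T hl) hS₁, ?_, _,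
          hτ₁.insert_update (hτ₂.mem l hl) hl2 hv fun m hm => ?_⟩
        · rw [Finset.card_insert_of_notMem hl2, hc₁]
        · exact hanti m (Finset.mem_union_left _ hm)
    · push Not at hadj
      obtain ⟨l, hl⟩ := Finset.card_pos.1 (by omega : 0 < S₂.card)
      have hl2 : l ∉ S₁ := hdisj l hl
      refine ⟨insert l S₁, Finset.insert_subset (hS₂T hl) hS₁, ?_, τ,
        hτ₁.insert (hτ₂.mem l hl) hl2 (hτ₂.pendant l hl) fun m hm => ?_⟩
      · rw [Finset.card_insert_of_notMem hl2, hc₁]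
      · exact hadj l (Finset.mem_union_right _ hl) m (Finset.mem_union_left _ hm)
          fun h => hl2 (h ▸ hm)

/-- If every `k + 1` edges of `𝒞` include two carrying adjacent leaves, large sets of edges
carry selections whose adjacencies are hard to cover. -/
lemma exists_uncovered {𝒞 : Set (Sym2 V)} {k : ℕ}
    (hpair : ∀ U : Finset (Sym2 V), (∀ e ∈ U, e ∈ 𝒞) → k + 1 ≤ U.card →
      ∃ e ∈ U, ∃ f ∈ U, e ≠ f ∧ ∃ t t', IsPendant G e t ∧ IsPendant G f t' ∧
        G.Adj t.leaf t'.leaf) (r : ℕ) :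
    ∀ U : Finset (Sym2 V), (∀ e ∈ U, e ∈ 𝒞) → k + 1 + 2 * r ≤ U.card →
      ∃ J ⊆ U, ∃ τ, (∀ e ∈ J, IsPendant G e (τ e)) ∧ Uncovered G J τ r := by
  classical
  induction r with
  | zero =>
    intro U hU hcard
    obtain ⟨e, he, f, hf, hne, t, t', ht, ht', hadj⟩ := hpair U hU (by omega)
    refine ⟨{e, f}, by simp [Finset.insert_subset_iff, he, hf], fun x => if x = e then t else t',
      ?_, ?_⟩
    · simp [ht, ht', hne.symm]
    · intro X hX
      obtain rfl : X = ∅ := Finset.card_eq_zero.1 (by omega)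
      exact ⟨e, by simp, f, by simp, by simp, by simp, hne, by simpa [hne.symm] using hadj⟩
  | succ r ih =>
    intro U hU hcard
    obtain ⟨e, he, f, hf, hne, t, t', ht, ht', hadj⟩ := hpair U hU (by omega)
    have hsub : ({e, f} : Finset (Sym2 V)) ⊆ U := by simp [Finset.insert_subset_iff, he, hf]
    obtain ⟨J, hJ, τ, hτ, hunc⟩ := ih (U \ {e, f})
      (fun x hx => hU x (Finset.mem_sdiff.1 hx).1)
      (by rw [Finset.card_sdiff_of_subset hsub, Finset.card_pair hne]; omega)
    have hJne : ∀ x ∈ J, x ≠ e ∧ x ≠ f := fun x hx => by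
      simpa using (Finset.mem_sdiff.1 (hJ hx)).2
    have hτ' : ∀ x ∈ J, (if x = e then t else if x = f then t' else τ x) = τ x := fun x hx => by
      simp [hJne x hx]
    refine ⟨{e, f} ∪ J, Finset.union_subset hsub (hJ.trans Finset.sdiff_subset),
      fun x => if x = e then t else if x = f then t' else τ x, ?_, ?_⟩
    · intro x hx
      rcases Finset.mem_union.1 hx with hx | hx
      · rcases Finset.mem_insert.1 hx with rfl | hx
        · simpa using ht
        · obtain rfl := Finset.mem_singleton.1 hx
          simpa [hne.symm] using ht'
      · simpa only [hτ' x hx] using hτ x hx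
    · intro X hX
      by_cases hX' : e ∉ X ∧ f ∉ X
      · exact ⟨e, by simp, f, by simp, hX'.1, hX'.2, hne, by simpa [hne.symm] using hadj⟩
      · obtain ⟨x, hx, hxef⟩ : ∃ x ∈ X, x = e ∨ x = f := by
          by_contra! h
          exact hX' ⟨fun he => (h e he).1 rfl, fun hf => (h f hf).2 rfl⟩
        obtain ⟨y, hy, z, hz, hyX, hzX, hyz, hadj'⟩ := hunc (X.erase x)
          (by rw [Finset.card_erase_of_mem hx]; omega)
        have key : ∀ y ∈ J, y ∉ X.erase x → y ∉ X := fun y hy hyX h =>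
          hyX (Finset.mem_erase.2 ⟨by
            rcases hxef with rfl | rfl
            exacts [(hJne y hy).1, (hJne y hy).2], h⟩)
        refine ⟨y, Finset.mem_union_right _ hy, z, Finset.mem_union_right _ hz, key y hy hyX,
          key z hz hzX, hyz, ?_⟩
        simpa only [hτ' y hy, hτ' z hz] using hadj'

/-- Unless there is an induced `P4 + kP3`, an exchange can be made at an edge of `J` whose leaf is
adjacent to another leaf at `J`. -/
lemma HasExchange.exists_of_uncovered {𝒞 : Set (Sym2 V)} (hex : HasExchange G 𝒞)
    (hfar : FarApart G 𝒞) {k r : ℕ} (hfree : IndFree G (p4kp3 k))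
    {L J : Finset (Sym2 V)} {τ : Sym2 V → Pendant V} (hL : IndepSel G 𝒞 L τ)
    (hLk : k + 1 ≤ L.card) (hJ : ∀ e ∈ J, e ∈ 𝒞 ∧ IsPendant G e (τ e))
    (hunc : Uncovered G J τ r) :
    ∃ J' ⊆ J, Uncovered G J' τ r ∧ ∃ l ∈ J', ∃ x ∈ J', G.Adj (τ l).leaf (τ x).leaf ∧
      ∃ v, IsInducedPendant G l ⟨(τ l).far, (τ l).near, v⟩ ∧
        (∀ m ∈ L, ¬ G.Adj v (τ m).leaf) ∧ ∀ m ∈ J', ¬ G.Adj v (τ m).leaf := by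
  classical
  let J' := J.filter fun e => ∃ f ∈ J, G.Adj (τ e).leaf (τ f).leaf
  have hsub : J' ⊆ J := Finset.filter_subset _ _
  have hunc' : Uncovered G J' τ r := by
    intro X hX
    obtain ⟨e, he, f, hf, heX, hfX, hne, hadj⟩ := hunc X hX
    exact ⟨e, Finset.mem_filter.2 ⟨he, f, hf, hadj⟩, f, Finset.mem_filter.2 ⟨hf, e, he, hadj.symm⟩,
      heX, hfX, hne, hadj⟩
  obtain ⟨e, he, f, hf, -, -, hne, hadj⟩ := hunc' ∅ (by simp)
  obtain ⟨l, hl, v, hv, hanti⟩ := hex (L ∪ J') τ (fun e he => by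
    rcases Finset.mem_union.1 he with he | he
    exacts [⟨hL.mem e he, (hL.pendant e he).toIsPendant⟩, hJ e (hsub he)])
    ⟨e, Finset.mem_union_right _ he, f, Finset.mem_union_right _ hf, hne, hadj⟩
  by_cases hlL : l ∈ L
  · have ht := hL.pendant l hlL
    have hlC := hL.mem l hlL
    have hleaf : ∀ z ∈ l, ∀ m ∈ L.erase l, ¬ G.Adj z (τ m).leaf := fun z hz m hm h =>
      hfar.not_adj (hL.mem m (Finset.mem_of_mem_erase hm)) hlC (Finset.ne_of_mem_erase hm)
        (hL.pendant m (Finset.mem_of_mem_erase hm)).attached_leaf hz h.symm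
    have hl' : l ∉ L.erase l := Finset.notMem_erase l L
    refine (not_indFree_of_indepSel hfar (hL.mono (Finset.erase_subset l L))
      (by rw [Finset.card_erase_of_mem hlL]; omega) hv.leaf_adj ht.adj.symm ht.leaf_adj.symm
      hv.leaf_not_adj (hanti l hl) (fun h => ht.leaf_not_adj h.symm)
      (fun m hm => hanti m (Finset.mem_union_left _ (Finset.mem_of_mem_erase hm)))
      (hleaf _ ht.far_mem) (hleaf _ ht.near_mem)
      (fun m hm => hL.indep l hlL m (Finset.mem_of_mem_erase hm) (Finset.ne_of_mem_erase hm).symm)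
      ⟨l, hlC, hl', hv.attached_leaf⟩ ⟨l, hlC, hl', ht.attached_far⟩
      ⟨l, hlC, hl', ht.attached_near⟩ ⟨l, hlC, hl', ht.attached_leaf⟩ hfree).elim
  · have hlJ : l ∈ J' := (Finset.mem_union.1 hl).resolve_left hlL
    obtain ⟨hlJ', x, hx, hlx⟩ := Finset.mem_filter.1 hlJ
    exact ⟨J', hsub, hunc', l, hlJ, x, Finset.mem_filter.2 ⟨hx, l, hlJ', hlx.symm⟩, hlx, v, hv,
      fun m hm => hanti m (Finset.mem_union_left _ hm),
      fun m hm => hanti m (Finset.mem_union_right _ hm)⟩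

/-- Repeated exchanges turn a large independent selection together with an uncovered one into
an induced `P4 + kP3`. -/
lemma HasExchange.not_indFree {𝒞 : Set (Sym2 V)} (hex : HasExchange G 𝒞)
    (hfar : FarApart G 𝒞) {k : ℕ} (r : ℕ) :
    ∀ (L W J : Finset (Sym2 V)) (τ : Sym2 V → Pendant V), IndepSel G 𝒞 L τ → k + 1 ≤ L.card →
      W ⊆ L → k ≤ W.card + r → (∀ e ∈ J, e ∈ 𝒞 ∧ IsPendant G e (τ e)) → (∀ e ∈ J, e ∉ L) →
      (∀ j ∈ J, ∀ w ∈ W, ¬ G.Adj (τ j).leaf (τ w).leaf) → Uncovered G J τ r →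
      ¬ IndFree G (p4kp3 k) := by
  classical
  induction r with
  | zero =>
    intro L W J τ hL hLk hWL hWk hJ hJL hJW hunc hfree
    obtain ⟨J', hJ', -, l, hl, x, hx, hlx, v, hv, hvL, hvJ⟩ :=
      hex.exists_of_uncovered hfar hfree hL hLk hJ hunc
    obtain ⟨hlC, ht⟩ := hJ l (hJ' hl)
    obtain ⟨hxC, hxt⟩ := hJ x (hJ' hx)
    have hlW : l ∉ W := fun h => hJL l (hJ' hl) (hWL h)
    have hxW : x ∉ W := fun h => hJL x (hJ' hx) (hWL h)
    have hW := hL.mono hWL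
    have hleaf : ∀ z ∈ l, ∀ m ∈ W, ¬ G.Adj z (τ m).leaf := fun z hz m hm h =>
      hfar.not_adj (hW.mem m hm) hlC (ne_of_mem_of_not_mem hm hlW)
        (hW.pendant m hm).attached_leaf hz h.symm
    have hvl : G.Adj v (τ l).far := hv.leaf_adj
    have hvW := fun m hm => hvL m (hWL hm)
    have hv' : ∃ e ∈ 𝒞, e ∉ W ∧ Attached G e v := ⟨l, hlC, hlW, hv.attached_leaf⟩
    have hf' : ∃ e ∈ 𝒞, e ∉ W ∧ Attached G e (τ l).far := ⟨l, hlC, hlW, ht.attached_far⟩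
    have hb' : ∃ e ∈ 𝒞, e ∉ W ∧ Attached G e (τ l).leaf := ⟨l, hlC, hlW, ht.attached_leaf⟩
    by_cases hfl : G.Adj (τ l).far (τ l).leaf
    · have hne : x ≠ l := fun h => hlx.ne (by rw [h])
      exact not_indFree_of_indepSel hfar hW (by omega) hvl hfl hlx (hvJ l hl) (hvJ x hx)
        (fun h => hfar.not_adj hxC hlC hne hxt.attached_leaf ht.far_mem h.symm) hvW
        (hleaf _ ht.far_mem) (hJW l (hJ' hl)) (hJW x (hJ' hx)) hv' hf' hb'
        ⟨x, hxC, hxW, hxt.attached_leaf⟩ hfree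
    · exact not_indFree_of_indepSel hfar hW (by omega) hvl ht.adj.symm ht.leaf_adj.symm
        hv.leaf_not_adj (hvJ l hl) hfl hvW (hleaf _ ht.far_mem) (hleaf _ ht.near_mem)
        (hJW l (hJ' hl)) hv' hf' ⟨l, hlC, hlW, ht.attached_near⟩ hb' hfree
  | succ r ih =>
    intro L W J τ hL hLk hWL hWk hJ hJL hJW hunc hfree
    obtain ⟨J', hJ', hunc', l, hl, -, -, -, v, hv, hvL, hvJ⟩ :=
      hex.exists_of_uncovered hfar hfree hL hLk hJ hunc
    have hlL := hJL l (hJ' hl)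
    set τ' := Function.update τ l ⟨(τ l).far, (τ l).near, v⟩ with hτ'
    have hτl : τ' l = ⟨(τ l).far, (τ l).near, v⟩ := Function.update_self ..
    have hτ : ∀ m, m ≠ l → τ' m = τ m := fun m hm => Function.update_of_ne hm _ _
    refine ih (insert l L) (insert l W) (J'.erase l) τ'
      (hL.insert_update (hJ l (hJ' hl)).1 hlL hv hvL) ?_ (Finset.insert_subset_insert l hWL) ?_
      ?_ ?_ ?_ ?_ hfree
    · exact hLk.trans (Finset.card_le_card (Finset.subset_insert l L))
    · rw [Finset.card_insert_of_notMem fun h => hlL (hWL h)]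
      omega
    · intro e he
      rw [hτ e (Finset.ne_of_mem_erase he)]
      exact hJ e (hJ' (Finset.mem_of_mem_erase he))
    · intro e he h
      rcases Finset.mem_insert.1 h with h | h
      exacts [Finset.ne_of_mem_erase he h, hJL e (hJ' (Finset.mem_of_mem_erase he)) h]
    · intro j hj w hw
      have hj' := Finset.mem_of_mem_erase hj
      rw [hτ j (Finset.ne_of_mem_erase hj)]
      rcases Finset.mem_insert.1 hw with h | h
      · rw [h, hτl]
        exact fun hadj => hvJ j hj' hadj.symm
      · rw [hτ w fun h' => hlL (hWL (h' ▸ h))]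
        exact hJW j (hJ' hj') w h
    · intro X hX
      obtain ⟨e, he, f, hf, heX, hfX, hne, hadj⟩ :=
        hunc' (insert l X) ((Finset.card_insert_le l X).trans (by omega))
      rw [Finset.mem_insert, not_or] at heX hfX
      exact ⟨e, Finset.mem_erase.2 ⟨heX.1, he⟩, f, Finset.mem_erase.2 ⟨hfX.1, hf⟩, heX.2, hfX.2,
        hne, by rwa [hτ e heX.1, hτ f hfX.1]⟩

/-- A large set of edges admitting exchanges, every `k + 1` of which include two carrying adjacent
leaves, forces an induced `P4 + kP3`. -/
lemma HasExchange.card_lt {𝒞 : Finset (Sym2 V)} (hex : HasExchange G 𝒞)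
    (hfar : FarApart G 𝒞) {k : ℕ} (hfree : IndFree G (p4kp3 k))
    (hpair : ∀ U ⊆ 𝒞, k + 1 ≤ U.card →
      ∃ e ∈ U, ∃ f ∈ U, e ≠ f ∧ ∃ t t', IsPendant G e t ∧ IsPendant G f t' ∧
        G.Adj t.leaf t'.leaf)
    (h1 : k + (1 + k * (k + 1) / 2) ≤ 𝒞.card) : 𝒞.card < 4 * k + 2 := by
  classical
  by_contra! h2
  let T := 𝒞.filter fun e => ∃ t, IsInducedPendant G e t
  have hT : T ⊆ 𝒞 := Finset.filter_subset _ _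
  have hTcard : (𝒞 \ T).card ≤ k := by
    by_contra! hlt
    obtain ⟨e, he, f, hf, hne, t, t', ht, ht', hadj⟩ := hpair (𝒞 \ T) Finset.sdiff_subset hlt
    have hmem : ∀ x ∈ ({e, f} : Finset (Sym2 V)), x ∈ 𝒞 \ T := by
      intro x hx
      rcases Finset.mem_insert.1 hx with rfl | hx
      · exact he
      · rwa [Finset.mem_singleton.1 hx]
    obtain ⟨l, hl, v, hv, -⟩ := hex {e, f} (fun x => if x = e then t else t')
      (fun x hx => ⟨(Finset.mem_sdiff.1 (hmem x hx)).1, by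
        rcases Finset.mem_insert.1 hx with rfl | hx
        · simpa using ht
        · obtain rfl := Finset.mem_singleton.1 hx
          simpa [hne.symm] using ht'⟩)
      ⟨e, by simp, f, by simp, hne, by simpa [hne.symm] using hadj⟩
    have := Finset.mem_sdiff.1 (hmem l hl)
    exact this.2 (Finset.mem_filter.2 ⟨this.1, _, hv⟩)
  rw [Finset.card_sdiff_of_subset hT] at hTcard
  obtain ⟨S, hST, hS, τ₁, hτ₁⟩ := hex.exists_indepSel k T
    (fun e he => Finset.mem_filter.1 he) (by omega)
  have hSC := hST.trans hT
  obtain ⟨J, hJ, τ₂, hτ₂, hunc⟩ := exists_uncovered (G := G) (𝒞 := 𝒞)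
    (fun U hU => hpair U hU) k (𝒞 \ S) (fun e he => (Finset.mem_sdiff.1 he).1)
    (by rw [Finset.card_sdiff_of_subset hSC]; omega)
  have hJS : ∀ e ∈ J, e ∉ S := fun e he => (Finset.mem_sdiff.1 (hJ he)).2
  let τ : Sym2 V → Pendant V := fun e => if e ∈ S then τ₁ e else τ₂ e
  have hτJ : ∀ e ∈ J, τ e = τ₂ e := fun e he => if_neg (hJS e he)
  refine hex.not_indFree hfar k S ∅ J τ (hτ₁.congr fun e he => if_pos he) hS.ge (by simp)
    (by simp) ?_ hJS (by simp) ?_ hfree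
  · intro e he
    rw [hτJ e he]
    exact ⟨(Finset.mem_sdiff.1 (hJ he)).1, hτ₂ e he⟩
  · intro X hX
    obtain ⟨e, he, f, hf, heX, hfX, hne, hadj⟩ := hunc X hX
    exact ⟨e, he, f, hf, heX, hfX, hne, by rwa [hτJ e he, hτJ f hf]⟩

/-- Edges spanned by a minimum total dominating set admit exchanges, if they are far apart and no
minimum total dominating set contains a `P3`. -/
lemma IsMinTotalDomSet.hasExchange [Finite V] {D : Set V} (hD : IsMinTotalDomSet G D)
    (hnoP3 : ∀ D' : Set V, IsMinTotalDomSet G D' → ¬ HasP3 G D') {𝒞 : Set (Sym2 V)}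
    (hfar : FarApart G 𝒞) (hmem : ∀ e ∈ 𝒞, ∀ x ∈ e, x ∈ D) : HasExchange G 𝒞 := by
  classical
  intro I τ hτ ⟨e, he, f, hf, hne, hadj⟩
  let D' : Set V := (D \ (fun i => (τ i).far) '' I) ∪ (fun i => (τ i).leaf) '' I
  have hatt : ∀ i ∈ I, ∀ j ∈ I, ∀ z, Attached G i z → Attached G j z → i = j := by
    intro i hi j hj z hz hz'
    by_contra h
    exact hfar.ne (hτ i hi).1 (hτ j hj).1 h hz hz' rfl
  have hfarD : (fun i => (τ i).far) '' (I : Set (Sym2 V)) ⊆ D := by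
    rintro _ ⟨i, hi, rfl⟩
    exact hmem i (hτ i hi).1 _ (hτ i hi).2.far_mem
  have hnear : ∀ i ∈ I, (τ i).near ∈ D' := by
    refine fun i hi => .inl ⟨hmem i (hτ i hi).1 _ (hτ i hi).2.near_mem, ?_⟩
    rintro ⟨j, hj, hji⟩
    have hji : (τ j).far = (τ i).near := hji
    obtain rfl := hatt i hi j hj _ (hτ i hi).2.attached_near (hji ▸ (hτ j hj).2.attached_far)
    exact (hτ i hi).2.adj.ne hji.symm
  have hleaf : ∀ i ∈ I, (τ i).leaf ∈ D' := fun i hi => .inr ⟨i, hi, rfl⟩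
  have hleafD : Disjoint (D \ (fun i => (τ i).far) '' (I : Set (Sym2 V)))
      ((fun i => (τ i).leaf) '' I) := by
    rw [Set.disjoint_right]
    rintro _ ⟨i, hi, rfl⟩ hiD
    obtain ⟨hiC, h⟩ := hτ i hi
    exact hnoP3 D hD ⟨_, _, _, hiD.1, hmem i hiC _ h.near_mem, hmem i hiC _ h.far_mem,
      h.leaf_adj.ne, h.adj.ne, h.leaf_ne, h.leaf_adj, h.adj⟩
  have hcard : D'.ncard = D.ncard := by
    rw [Set.ncard_union_eq hleafD (Set.toFinite _) (Set.toFinite _),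
      Set.ncard_sdiff hfarD (Set.toFinite _),
      Set.InjOn.ncard_image (s := (I : Set (Sym2 V))) (f := fun i => (τ i).leaf)
        fun i hi j hj hij => hatt i hi j hj _ (hτ i hi).2.attached_leaf
          (by rw [show (τ i).leaf = (τ j).leaf from hij]; exact (hτ j hj).2.attached_leaf)]
    have h1 : ((fun i => (τ i).far) '' (I : Set (Sym2 V))).ncard = (I : Set (Sym2 V)).ncard :=
      Set.InjOn.ncard_image fun i hi j hj hij => hatt i hi j hj _ (hτ i hi).2.attached_far
        (by rw [show (τ i).far = (τ j).far from hij]; exact (hτ j hj).2.attached_far)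
    have h2 := Set.ncard_le_ncard hfarD (Set.toFinite _)
    omega
  have hP3 : HasP3 G D' := ⟨_, _, _, hnear e he, hleaf e he, hleaf f hf, (hτ e he).2.leaf_adj.ne',
    hadj.ne, hfar.ne (hτ e he).1 (hτ f hf).1 hne (hτ e he).2.attached_near
      (hτ f hf).2.attached_leaf, (hτ e he).2.leaf_adj.symm, hadj⟩
  have hnot : ¬ IsTotalDomSet G D' := fun h => hnoP3 D' ⟨h, hcard.trans hD.2⟩ hP3
  simp only [IsTotalDomSet, not_forall, not_exists, not_and] at hnot
  obtain ⟨v, hv⟩ := hnot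
  obtain ⟨u, hu, hvu⟩ := hD.1 v
  have hu' : u ∈ (fun i => (τ i).far) '' (I : Set (Sym2 V)) := by
    by_contra h
    exact hv u (.inl ⟨hu, h⟩) hvu
  obtain ⟨l, hl, rfl⟩ := hu'
  obtain ⟨-, hlt⟩ := hτ l hl
  have hne : v ≠ (τ l).near := fun h => hv _ (hleaf l hl) (h ▸ hlt.leaf_adj.symm)
  exact ⟨l, hl, v, ⟨⟨Sym2.eq_swap.trans hlt.edge_eq, hlt.adj.symm, hvu, hne⟩, hv _ (hnear l hl)⟩,
    fun m hm => hv _ (hleaf m hm)⟩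

lemma farApart_of_le_setDist (hconn : G.Connected) {𝒞 : Set (Sym2 V)}
    (hdist : ∀ e ∈ 𝒞, ∀ e' ∈ 𝒞, e ≠ e' → 3 ≤ setDist G {v : V | v ∈ e} {v : V | v ∈ e'}) :
    FarApart G 𝒞 := by
  intro e he e' he' hne x hx y hy
  have h : 3 ≤ G.dist x y := (hdist e he e' he' hne).trans (Nat.sInf_le ⟨x, hx, y, hy, rfl⟩)
  refine ⟨?_, ?_, ?_⟩
  · rintro rfl
    simp at h
  · intro hxy
    have := dist_eq_one_iff_adj.2 hxy
    omega
  · intro z hzx hzy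
    have := hconn.dist_triangle (u := x) (v := z) (w := y)
    have h1 := dist_eq_one_iff_adj.2 hzx.symm
    have h2 := dist_eq_one_iff_adj.2 hzy
    omega

/-- An induced `P4` meeting two far apart edges in one vertex each joins leaves at the edges. -/
lemma FarApart.exists_isPendant {𝒞 : Set (Sym2 V)} (hfar : FarApart G 𝒞) {e₁ e₂ : Sym2 V}
    (h₁ : e₁ ∈ 𝒞) (h₂ : e₂ ∈ 𝒞) (hne : e₁ ≠ e₂) (hadj : ∀ e ∈ 𝒞, e ∈ G.edgeSet)
    (f : pathGraph 4 ↪g G) {i j : Fin 4} (hi : f i ∈ e₁) (hj : f j ∈ e₂)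
    (hf : ∀ l, l ≠ i → l ≠ j → f l ∉ e₁ ∧ f l ∉ e₂) :
    ∃ t t', IsPendant G e₁ t ∧ IsPendant G e₂ t' ∧ G.Adj t.leaf t'.leaf := by
  have key : ∀ e ∈ 𝒞, ∀ x ∈ e, ∀ z ∉ e, G.Adj z x → ∃ y, IsPendant G e ⟨x, y, z⟩ := by
    intro e he x hx z hz hzx
    obtain ⟨y, rfl⟩ := hx
    exact ⟨y, rfl, hadj _ he, hzx, fun h : z = y => hz (h ▸ Sym2.mem_mk_right x y)⟩
  have hends : (i = 0 ∧ j = 3) ∨ (i = 3 ∧ j = 0) := by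
    obtain ⟨h1, h2, h3⟩ := hfar e₁ h₁ e₂ h₂ hne _ hi _ hj
    have h4 : i ≠ j := fun h => h1 (h ▸ rfl)
    have h5 : ¬ (pathGraph 4).Adj i j := fun h => h2 (f.map_rel_iff.2 h)
    have h6 : ∀ m, (pathGraph 4).Adj m i → ¬ (pathGraph 4).Adj m j := fun m h h' =>
      h3 (f m) (f.map_rel_iff.2 h) (f.map_rel_iff.2 h')
    simp only [pathGraph_adj] at h5 h6
    revert h4 h5 h6
    clear * -
    revert i j
    decide
  have e01 : G.Adj (f 0) (f 1) := f.map_rel_iff.2 (by simp [pathGraph_adj])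
  have e12 : G.Adj (f 1) (f 2) := f.map_rel_iff.2 (by simp [pathGraph_adj])
  have e23 : G.Adj (f 2) (f 3) := f.map_rel_iff.2 (by simp [pathGraph_adj])
  rcases hends with ⟨rfl, rfl⟩ | ⟨rfl, rfl⟩
  · obtain ⟨y, hy⟩ := key e₁ h₁ _ hi (f 1) (hf 1 (by decide) (by decide)).1 e01.symm
    obtain ⟨z, hz⟩ := key e₂ h₂ _ hj (f 2) (hf 2 (by decide) (by decide)).2 e23
    exact ⟨_, _, hy, hz, e12⟩
  · obtain ⟨y, hy⟩ := key e₁ h₁ _ hi (f 2) (hf 2 (by decide) (by decide)).1 e23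
    obtain ⟨z, hz⟩ := key e₂ h₂ _ hj (f 1) (hf 1 (by decide) (by decide)).2 e01.symm
    exact ⟨_, _, hy, hz, e12.symm⟩

end Pendants

end TD

theorem stmt18 {V : Type*} [Fintype V] (k : ℕ) (hk : 1 ≤ k)
    (G : SimpleGraph V) (hconn : G.Connected) (hfree : IndFree G (p4kp3 k))
    (A B C : Set V) (hA : Nonempty (G.induce A ≃g p4kp3 (k - 1)))
    (hB : B = {v | v ∉ A ∧ ∃ a ∈ A, G.Adj v a})
    (hC : C = {v | v ∉ A ∧ v ∉ B})
    (hnoP3 : ∀ D' : Set V, IsMinTotalDomSet G D' → ¬ HasP3 G D')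
    (D : Set V) (hD : IsMinTotalDomSet G D)
    (𝒞 : Set (Sym2 V))
    (hCedge : ∀ e ∈ 𝒞, ∃ x y : V, e = s(x, y) ∧ G.Adj x y ∧ x ∈ D ∧ y ∈ D ∧ x ∈ C ∧ y ∈ C)
    (hCdist : ∀ e ∈ 𝒞, ∀ e' ∈ 𝒞, e ≠ e' →
      3 ≤ setDist G {v : V | v ∈ e} {v : V | v ∈ e'})
    (hP4 : ∀ E : Set (Sym2 V), E ⊆ 𝒞 → E.ncard = k + 1 →
      ∃ f : pathGraph 4 ↪g G, ∃ i j : Fin 4, i ≠ j ∧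
        (∃ e₁ ∈ E, ∃ e₂ ∈ E, e₁ ≠ e₂ ∧ f i ∈ e₁ ∧ f j ∈ e₂) ∧
        ∀ l : Fin 4, l ≠ i → l ≠ j → ∀ e ∈ E, f l ∉ e) :
    (𝒞.ncard : ℚ) <
      ((k : ℚ) ^ 2 / 2 + 3 * k / 2) * ((k : ℚ) ^ 2 / 2 + 3 * k / 2 + 1) + k + 1 := by
  classical
  have hfar := farApart_of_le_setDist hconn hCdist
  have hmem : ∀ e ∈ 𝒞, ∀ x ∈ e, x ∈ D := by
    intro e he z hz
    obtain ⟨x, y, rfl, -, hx, hy, -⟩ := hCedge e he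
    rcases Sym2.mem_iff.1 hz with rfl | rfl <;> assumption
  have hadj : ∀ e ∈ 𝒞, e ∈ G.edgeSet := by
    intro e he
    obtain ⟨x, y, rfl, h, -⟩ := hCedge e he
    exact h
  have hex := hD.hasExchange hnoP3 hfar hmem
  lift 𝒞 to Finset (Sym2 V) using Set.toFinite 𝒞
  rw [Set.ncard_coe_finset]
  have hpair : ∀ U ⊆ 𝒞, k + 1 ≤ U.card → ∃ e ∈ U, ∃ f ∈ U, e ≠ f ∧
      ∃ t t', IsPendant G e t ∧ IsPendant G f t' ∧ G.Adj t.leaf t'.leaf := by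
    intro U hU hcard
    obtain ⟨E, hEU, hE⟩ := Finset.exists_subset_card_eq hcard
    obtain ⟨f, i, j, -, ⟨e₁, he₁, e₂, he₂, hne, hi, hj⟩, hf⟩ := hP4 E
      (by exact_mod_cast hEU.trans hU) (by rw [Set.ncard_coe_finset, hE])
    exact ⟨e₁, hEU he₁, e₂, hEU he₂, hne, hfar.exists_isPendant (hU (hEU he₁)) (hU (hEU he₂)) hne
      hadj f hi hj fun l hli hlj => ⟨hf l hli hlj e₁ he₁, hf l hli hlj e₂ he₂⟩⟩
  have hcard := hex.card_lt hfar hfree hpair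
  have hk' : (1 : ℚ) ≤ k := by exact_mod_cast hk
  by_contra! hle
  have h1 : k + (1 + k * (k + 1) / 2) ≤ 𝒞.card := by
    rw [← Nat.cast_le (α := ℚ)]
    have := Nat.cast_div_le (α := ℚ) (m := k * (k + 1)) (n := 2)
    push_cast at this ⊢
    nlinarith [mul_nonneg (sub_nonneg.2 hk') (sq_nonneg (k : ℚ)), pow_pos (zero_lt_one.trans_le hk') 3]
  have h2 : (𝒞.card : ℚ) < 4 * k + 2 := by exact_mod_cast hcard h1
  nlinarith [mul_nonneg (sub_nonneg.2 hk') (sq_nonneg (k : ℚ)),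
    mul_nonneg (sub_nonneg.2 hk') (sub_nonneg.2 hk'), pow_pos (zero_lt_one.trans_le hk') 3,
    pow_pos (zero_lt_one.trans_le hk') 4]
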